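/- Let ξ be standard Gaussian in R^p and B a symmetric p×p matrix with λ_max(B²) = 1. Set 𝚙 = tr(B²) and 𝚟² = 2·tr(B⁴). Then for every x > 0, P(‖Bξ‖² > 𝚙 + max(2𝚟√x, 6x)) ≤ exp(-x). -/

import Mathlib

open MeasureTheory ProbabilityTheory Real Matrix

theorem one_le_one_sub_mul_exp_add_sq {u : ℝ} (h0 : 0 ≤ u) (h1 : u ≤ 2 / 3) :
    1 ≤ (1 - u) * exp (u + u ^ 2) := by
  have hexp := Real.sum_le_exp_of_nonneg (show 0 ≤ u + u ^ 2 by positivity) 5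
  simp only [Finset.sum_range_succ, Finset.sum_range_zero, Nat.factorial] at hexp
  norm_num at hexp
  have hpow (k : ℕ) : u ^ k ≤ (2 / 3) ^ k := pow_le_pow_left₀ h0 h1 k
  have hpoly : 0 ≤ 12 - 8 * u - 3 * u ^ 2 - 9 * u ^ 3 - 6 * u ^ 4 - 6 * u ^ 5 - 3 * u ^ 6
      - u ^ 7 := by
    linarith [hpow 2, hpow 3, hpow 4, hpow 5, hpow 6, hpow 7]
  have hmul := mul_le_mul_of_nonneg_left hexp (show 0 ≤ 1 - u by linarith)
  nlinarith [mul_nonneg (sq_nonneg u) hpoly]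

theorem gaussianPDFReal_zero_one_mul_exp_sq (s y : ℝ) :
    gaussianPDFReal 0 1 y * exp (s * y ^ 2) = (√(2 * π))⁻¹ * exp (-(1 / 2 - s) * y ^ 2) := by
  rw [gaussianPDFReal_def, mul_assoc, ← Real.exp_add]
  simp only [NNReal.coe_one, mul_one]
  congr 2
  ring

theorem integrable_exp_mul_sq_gaussianReal {s : ℝ} (hs : s < 1 / 2) :
    Integrable (fun y ↦ exp (s * y ^ 2)) (gaussianReal 0 1) := by
  rw [gaussianReal_of_var_ne_zero _ one_ne_zero,
    integrable_withDensity_iff_integrable_smul' (measurable_gaussianPDF _ _)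
      (ae_of_all _ fun _ ↦ gaussianPDF_lt_top)]
  simp only [toReal_gaussianPDF, smul_eq_mul, gaussianPDFReal_zero_one_mul_exp_sq]
  exact (integrable_exp_neg_mul_sq (by linarith)).const_mul _

theorem integral_exp_mul_sq_gaussianReal (s : ℝ) :
    ∫ y, exp (s * y ^ 2) ∂(gaussianReal 0 1) = √((1 - 2 * s)⁻¹) := by
  rw [integral_gaussianReal_eq_integral_smul one_ne_zero]
  simp only [smul_eq_mul, gaussianPDFReal_zero_one_mul_exp_sq]
  rw [integral_const_mul, integral_gaussian, ← Real.sqrt_inv, ← Real.sqrt_mul (by positivity)]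
  congr 1
  rw [show 1 / 2 - s = (1 - 2 * s) / 2 by ring]
  rcases eq_or_ne (1 - 2 * s) 0 with h | h
  · simp [h]
  · field_simp

theorem integral_exp_mul_sq_gaussianReal_le {u : ℝ} (h0 : 0 ≤ u) (h1 : u ≤ 2 / 3) :
    ∫ y, exp (u / 2 * y ^ 2) ∂(gaussianReal 0 1) ≤ exp ((u + u ^ 2) / 2) := by
  rw [integral_exp_mul_sq_gaussianReal]
  refine Real.sqrt_le_iff.2 ⟨(exp_pos _).le, ?_⟩
  have hu : 0 < 1 - u := by linarith
  rw [← Real.exp_nat_mul, Nat.cast_ofNat, mul_div_cancel₀ _ two_ne_zero,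
    mul_div_cancel₀ _ two_ne_zero, inv_le_iff_one_le_mul₀' hu]
  exact one_le_one_sub_mul_exp_add_sq h0 h1

theorem pi_gaussianReal_weighted_sum_sq_ge_le {ι : Type*} [Fintype ι] {a : ι → ℝ}
    (ha0 : ∀ i, 0 ≤ a i) (ha1 : ∀ i, a i ≤ 1) {m : ℝ} (hm0 : 0 ≤ m) (hm1 : m ≤ 2 / 3) (z : ℝ) :
    (Measure.pi fun _ : ι ↦ gaussianReal 0 1).real {y | (∑ i, a i) + z ≤ ∑ i, a i * y i ^ 2}
      ≤ exp (-(m / 2) * z + m ^ 2 / 2 * ∑ i, a i ^ 2) := by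
  have hma0 (i : ι) : 0 ≤ m * a i := mul_nonneg hm0 (ha0 i)
  have hma1 (i : ι) : m * a i ≤ 2 / 3 := by nlinarith [ha1 i]
  have hprod (y : ι → ℝ) :
      exp (m / 2 * ∑ i, a i * y i ^ 2) = ∏ i, exp (m * a i / 2 * y i ^ 2) := by
    rw [← Real.exp_sum, Finset.mul_sum]
    congr 1
    exact Finset.sum_congr rfl fun i _ ↦ by ring
  have hint : Integrable (fun y : ι → ℝ ↦ exp (m / 2 * ∑ i, a i * y i ^ 2))
      (Measure.pi fun _ : ι ↦ gaussianReal 0 1) := by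
    simp only [hprod]
    exact Integrable.fintype_prod (f := fun i y ↦ exp (m * a i / 2 * y ^ 2)) fun i ↦
      integrable_exp_mul_sq_gaussianReal (by linarith [hma1 i])
  refine (measure_ge_le_exp_mul_mgf _ (by positivity) hint).trans ?_
  have hmgf : mgf (fun y : ι → ℝ ↦ ∑ i, a i * y i ^ 2)
      (Measure.pi fun _ : ι ↦ gaussianReal 0 1) (m / 2) ≤
        exp (∑ i, (m * a i + (m * a i) ^ 2) / 2) := by
    simp only [mgf, hprod]
    rw [integral_fintype_prod_eq_prod (f := fun i y ↦ exp (m * a i / 2 * y ^ 2)), Real.exp_sum]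
    exact Finset.prod_le_prod (fun i _ ↦ integral_nonneg fun _ ↦ (exp_pos _).le)
      fun i _ ↦ integral_exp_mul_sq_gaussianReal_le (hma0 i) (hma1 i)
  refine (mul_le_mul_of_nonneg_left hmgf (exp_pos _).le).trans_eq ?_
  rw [← Real.exp_add, ← Finset.sum_div, Finset.sum_add_distrib]
  simp only [mul_pow, ← Finset.mul_sum]
  congr 1
  ring

theorem pi_gaussianReal_weighted_sum_sq_deviation {ι : Type*} [Fintype ι] {a : ι → ℝ}
    (ha0 : ∀ i, 0 ≤ a i) (ha1 : ∀ i, a i ≤ 1) {v : ℝ} (hv0 : 0 ≤ v)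
    (hv : v ^ 2 = 2 * ∑ i, a i ^ 2) {x : ℝ} (hx : 0 < x) :
    (Measure.pi fun _ : ι ↦ gaussianReal 0 1).real
      {y | (∑ i, a i) + max (2 * v * √x) (6 * x) ≤ ∑ i, a i * y i ^ 2} ≤ exp (-x) := by
  have hsx : 0 < √x := Real.sqrt_pos.2 hx
  have hsq : √x ^ 2 = x := Real.sq_sqrt hx.le
  have hsum : ∑ i, a i ^ 2 = v ^ 2 / 2 := by linarith
  rcases le_total (3 * √x) v with h | h
  · have hvpos : 0 < v := by linarith
    refine (pi_gaussianReal_weighted_sum_sq_ge_le ha0 ha1 (m := 2 * √x / v) (by positivity)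
      (by rw [div_le_iff₀ hvpos]; linarith) _).trans (Real.exp_le_exp.2 ?_)
    rw [max_eq_left (by nlinarith), hsum]
    apply le_of_eq
    field_simp
    linear_combination -hsq
  · refine (pi_gaussianReal_weighted_sum_sq_ge_le ha0 ha1 (m := 2 / 3) (by norm_num) le_rfl
      _).trans (Real.exp_le_exp.2 ?_)
    rw [max_eq_right (by nlinarith), hsum]
    nlinarith

theorem Matrix.IsHermitian.trace_mul_self_eq_sum_sq_eigenvalues {n : Type*} [Fintype n]
    [DecidableEq n] {A : Matrix n n ℝ} (hA : A.IsHermitian) :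
    (A * A).trace = ∑ i, hA.eigenvalues i ^ 2 := by
  have h := hA.spectral_theorem
  generalize hD : diagonal (RCLike.ofReal ∘ hA.eigenvalues : n → ℝ) = D at h
  have h2 : A * A = Unitary.conjStarAlgAut ℝ _ hA.eigenvectorUnitary (D * D) := by
    rw [map_mul, ← h]
  rw [h2, Unitary.conjStarAlgAut_apply, trace_mul_comm, ← mul_assoc, Unitary.coe_star_mul_self,
    one_mul, ← hD, diagonal_mul_diagonal, trace_diagonal]
  simp [sq]

theorem Matrix.IsHermitian.dotProduct_mulVec_sum_smul_eigenvectorBasis {n : Type*} [Fintype n]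
    [DecidableEq n] {A : Matrix n n ℝ} (hA : A.IsHermitian) (y : n → ℝ) :
    (∑ i, y i • hA.eigenvectorBasis i).ofLp ⬝ᵥ (A *ᵥ (∑ i, y i • hA.eigenvectorBasis i).ofLp) =
      ∑ i, hA.eigenvalues i * y i ^ 2 := by
  have h : A *ᵥ (∑ i, y i • hA.eigenvectorBasis i).ofLp =
      (∑ i, (hA.eigenvalues i * y i) • hA.eigenvectorBasis i).ofLp := by
    simp only [WithLp.ofLp_sum, WithLp.ofLp_smul, mulVec_sum, mulVec_smul,
      hA.mulVec_eigenvectorBasis, smul_smul]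
    exact Finset.sum_congr rfl fun i _ ↦ by rw [mul_comm]
  have hinner := hA.eigenvectorBasis.orthonormal.inner_sum
    (fun i ↦ hA.eigenvalues i * y i) y Finset.univ
  rw [h]
  rw [EuclideanSpace.inner_eq_star_dotProduct] at hinner
  simp only [star_trivial, conj_trivial] at hinner
  rw [hinner]
  exact Finset.sum_congr rfl fun i _ ↦ by ring

theorem Matrix.IsHermitian.map_pi_gaussianReal_eigenvectorBasis {n : Type*} [Fintype n]
    [DecidableEq n] {A : Matrix n n ℝ} (hA : A.IsHermitian) :
    (Measure.pi fun _ : n ↦ gaussianReal 0 1).map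
        (fun y ↦ (∑ i, y i • hA.eigenvectorBasis i).ofLp) =
      Measure.pi fun _ : n ↦ gaussianReal 0 1 := by
  have h := stdGaussian_eq_map_pi_orthonormalBasis hA.eigenvectorBasis
  rw [← map_pi_eq_stdGaussian] at h
  have h2 := congrArg (Measure.map (WithLp.ofLp (p := 2) (V := n → ℝ))) h
  rw [Measure.map_map (by fun_prop) (by fun_prop),
    Measure.map_map (by fun_prop) (by fun_prop)] at h2
  exact h2.symm.trans Measure.map_id

theorem gaussian_quadratic_form_deviation
    {Ω : Type*} [MeasureSpace Ω] (P : Measure Ω) [IsProbabilityMeasure P]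
    {n : ℕ} (hn : 0 < n) (ξ : Ω → Fin n → ℝ) (hξ : Measurable ξ)
    (hlaw : Measure.map ξ P = Measure.pi fun _ : Fin n => gaussianReal 0 1)
    (B : Matrix (Fin n) (Fin n) ℝ) (hB : B.IsHermitian)
    (hB2 : (B * B).IsHermitian)
    (hmax : (⨆ i, hB2.eigenvalues i) = 1)
    (p v : ℝ) (hp : p = Matrix.trace (B * B)) (hv0 : 0 ≤ v)
    (hv : v ^ 2 = 2 * Matrix.trace (B * B * B * B))
    (x : ℝ) (hx : 0 < x) :
    P {ω | p + max (2 * v * Real.sqrt x) (6 * x) < ∑ i, (B.mulVec (ξ ω)) i ^ 2}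
      ≤ ENNReal.ofReal (Real.exp (-x)) := by
  have ha0 : ∀ i, 0 ≤ hB2.eigenvalues i := by
    have hpsd : (B * B).PosSemidef := by
      simpa only [hB.eq] using posSemidef_conjTranspose_mul_self B
    exact fun i ↦ hpsd.eigenvalues_nonneg i
  have ha1 (i : Fin n) : hB2.eigenvalues i ≤ 1 :=
    hmax ▸ le_ciSup (Set.finite_range _).bddAbove i
  have hp' : p = ∑ i, hB2.eigenvalues i := by
    simpa [hp] using hB2.trace_eq_sum_eigenvalues
  have hv' : v ^ 2 = 2 * ∑ i, hB2.eigenvalues i ^ 2 := by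
    rw [hv, ← hB2.trace_mul_self_eq_sum_sq_eigenvalues, mul_assoc (B * B)]
  have hquad (w : Fin n → ℝ) : ∑ i, (B *ᵥ w) i ^ 2 = w ⬝ᵥ ((B * B) *ᵥ w) := by
    have hBt : Bᵀ = B := by simpa using hB.eq
    rw [← mulVec_mulVec, dotProduct_mulVec, ← mulVec_transpose, hBt]
    simp [dotProduct, sq]
  set z := max (2 * v * √x) (6 * x) with hz
  have hmeas : MeasurableSet {w : Fin n → ℝ | p + z < ∑ i, (B *ᵥ w) i ^ 2} := by
    have : Continuous fun w : Fin n → ℝ ↦ ∑ i, (B *ᵥ w) i ^ 2 := by fun_prop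
    exact measurableSet_lt measurable_const this.measurable
  calc P {ω | p + z < ∑ i, (B *ᵥ ξ ω) i ^ 2}
      = (Measure.pi fun _ : Fin n ↦ gaussianReal 0 1)
          {w | p + z < ∑ i, (B *ᵥ w) i ^ 2} := by
        rw [← hlaw, Measure.map_apply hξ hmeas]
        rfl
    _ = (Measure.pi fun _ : Fin n ↦ gaussianReal 0 1)
          {y | p + z < ∑ i, hB2.eigenvalues i * y i ^ 2} := by
        conv_lhs => rw [← hB2.map_pi_gaussianReal_eigenvectorBasis]
        rw [Measure.map_apply (by fun_prop) hmeas]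
        simp only [Set.preimage_ofPred_eq, hquad,
          hB2.dotProduct_mulVec_sum_smul_eigenvectorBasis]
    _ ≤ (Measure.pi fun _ : Fin n ↦ gaussianReal 0 1)
          {y | p + z ≤ ∑ i, hB2.eigenvalues i * y i ^ 2} :=
        measure_mono (Set.ofPred_subset_ofPred.2 fun _ ↦ le_of_lt)
    _ ≤ ENNReal.ofReal (exp (-x)) := by
        rw [← ofReal_measureReal, hp', hz]
        exact ENNReal.ofReal_le_ofReal
          (pi_gaussianReal_weighted_sum_sq_deviation ha0 ha1 hv0 hv' hx)
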